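/- Higher dissipation identity (Lemma 5.3, classical form): let ε > 0, T > 0 and r ≥ 2 be real. Let u: [0,T]×ℝ³ → ℝ³ be C¹ and 2π-periodic in each space coordinate, and let f: [0,T]×ℝ³×ℝ³ → [0,∞) be C¹, 2π-periodic in x, vanishing whenever |v| ≥ R₀ for some fixed R₀ > 0, and satisfy pointwise ∂ₜf + v·∇ₓf + (1/ε) div_v[f(u − v)] = 0. Then for every T′ ∈ [0,T]: ∫₀^{T′} ∫_{𝕋³×ℝ³} f(t,x,v) |v − u(t,x)|^r/ε^r dx dv dt = −(1/r) [ ∫_{𝕋³×ℝ³} f(T′,x,v) |v − u(T′,x)|^r/ε^{r−1} dx dv − ∫_{𝕋³×ℝ³} f(0,x,v) |v − u(0,x)|^r/ε^{r−1} dx dv ] − ∫₀^{T′} ∫_{𝕋³×ℝ³} f(t,x,v) [ (∂ₜu)(t,x) + (Dₓu)(t,x) v ] · (v − u(t,x)) |v − u(t,x)|^{r−2} / ε^{r−1} dx dv dt, with the convention that the integrand of the last integral vanishes where v = u(t,x). -/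

import Mathlib

noncomputable section

open MeasureTheory Real RealInnerProductSpace

/-- Euclidean three-dimensional space, in which both positions and velocities live. -/
abbrev E3 : Type := EuclideanSpace ℝ (Fin 3)

/-- The `i`-th vector of the standard basis of `E3`. -/
def e3 (i : Fin 3) : E3 := EuclideanSpace.single i 1

/-- The fundamental cube `[0, 2π]³` of the torus `𝕋³ = ℝ³/(2πℤ)³`. -/
def cube3 : Set E3 := {x : E3 | ∀ i, x i ∈ Set.Icc (0 : ℝ) (2 * π)}

/-- Normalized integral over the torus `𝕋³` of a (`2π`-periodic) scalar function:
`∫_{𝕋³} g dx := (2π)⁻³ ∫_{[0,2π]³} g(x) dx`. -/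
def intT3 (g : E3 → ℝ) : ℝ := ((2 * π) ^ 3)⁻¹ * ∫ x in cube3, g x

lemma map_eq_sum_e3 (L : E3 →L[ℝ] ℝ) (w : E3) : L w = ∑ i, w i * L (e3 i) := by
  have h : w = ∑ i, w i • e3 i := by
    ext j
    simp [e3, Finset.sum_apply, Pi.single_apply]
  conv_lhs => rw [h]
  simp

lemma isCompact_cube3 : IsCompact cube3 := by
  have h : cube3 = (EuclideanSpace.equiv (Fin 3) ℝ).toHomeomorph ⁻¹'
      Set.Icc (fun _ => 0) (fun _ => 2 * π) := by
    ext x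
    simp [cube3, Pi.le_def, forall_and]
  rw [h, Homeomorph.isCompact_preimage]
  exact isCompact_Icc

/-- The integral over the cube of a directional derivative of a periodic function vanishes. -/
lemma integral_cube3_fderiv_eq_zero (g : E3 → ℝ) (hg : ContDiff ℝ 1 g)
    (hper : ∀ (x : E3) (i : Fin 3), g (x + (2 * π) • e3 i) = g x) (w : E3) :
    ∫ x in cube3, fderiv ℝ g x w = 0 := by
  let e : (Fin 3 → ℝ) ≃L[ℝ] E3 := (EuclideanSpace.equiv (Fin 3) ℝ).symm
  have he : ∀ i, e (Pi.single i 1) = e3 i := fun i => rfl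
  have hd : ∀ x, HasFDerivAt (fun y => g (e y))
      ((fderiv ℝ g (e x)).comp (e : (Fin 3 → ℝ) →L[ℝ] E3)) x := fun x =>
    ((hg.differentiable one_ne_zero (e x)).hasFDerivAt).comp x e.hasFDerivAt
  have hcont : Continuous (fderiv ℝ g) := hg.continuous_fderiv one_ne_zero
  have hdiv := integral_divergence_of_hasFDerivAt_off_countable'
    (E := ℝ) (n := 2) (fun _ => 0) (fun _ => 2 * π) (fun _ => by positivity)
    (fun i y => w i * g (e y))
    (fun i y => w i • (fderiv ℝ g (e y)).comp (e : (Fin 3 → ℝ) →L[ℝ] E3)) ∅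
    Set.countable_empty
    (fun i => (continuous_const.mul (hg.continuous.comp e.continuous)).continuousOn)
    (fun x _ i => (hd x).const_mul (w i))
    (by
      refine Continuous.integrableOn_Icc ?_
      refine continuous_finsetSum _ fun i _ => ?_
      have : Continuous fun y => fderiv ℝ g (e y) := hcont.comp e.continuous
      simp only [smul_apply, ContinuousLinearMap.comp_apply]
      fun_prop)
  have hface : ∀ (i : Fin 3) (y : Fin 2 → ℝ),
      g (e (i.insertNth (2 * π) y)) = g (e (i.insertNth 0 y)) := by
    intro i y
    rw [← hper (e (i.insertNth 0 y)) i, ← he, ← map_smul, ← map_add]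
    congr 2
    ext j
    rcases eq_or_ne j i with rfl | hj
    · simp
    · obtain ⟨k, rfl⟩ := Fin.exists_succAbove_eq hj
      simp
  rw [Finset.sum_eq_zero (fun i _ => by simp only [hface, sub_self])] at hdiv
  have hpre : (WithLp.toLp 2 : (Fin 3 → ℝ) → E3) ⁻¹' cube3 = Set.Icc (fun _ : Fin 3 => (0 : ℝ)) (fun _ => 2 * π) := by
    ext x
    simp [cube3, Pi.le_def, forall_and]
  rw [← (PiLp.volume_preserving_toLp (Fin 3)).setIntegral_preimage_emb
    (MeasurableEquiv.toLp 2 (Fin 3 → ℝ)).measurableEmbedding, hpre]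
  refine Eq.trans ?_ hdiv
  refine setIntegral_congr_fun measurableSet_Icc fun x _ => ?_
  change fderiv ℝ g (e x) w = _
  rw [map_eq_sum_e3]
  rfl

/-- Integration by parts against the affine field `c - v`. -/
lemma integral_fderiv_sub_eq (g : E3 → ℝ) (hg : ContDiff ℝ 1 g) (hs : HasCompactSupport g)
    (c : E3) : ∫ v, fderiv ℝ g v (c - v) = 3 * ∫ v, g v := by
  have hcont : Continuous (fderiv ℝ g) := hg.continuous_fderiv one_ne_zero
  have hd : ∀ (i : Fin 3) (v : E3), HasFDerivAt (fun v : E3 => c i - v i)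
      (-(EuclideanSpace.proj i : E3 →L[ℝ] ℝ)) v := fun i v =>
    (EuclideanSpace.proj i : E3 →L[ℝ] ℝ).hasFDerivAt.const_sub (c i)
  have hint : ∀ i : Fin 3, Integrable fun v : E3 => (c i - v i) * fderiv ℝ g v (e3 i) := by
    intro i
    refine Continuous.integrable_of_hasCompactSupport (by fun_prop) ?_
    exact ((hs.fderiv (𝕜 := ℝ)).comp_left (g := fun L : E3 →L[ℝ] ℝ => L (e3 i)) rfl).mul_left
  have hgint : Integrable g := hg.continuous.integrable_of_hasCompactSupport hs
  have key : ∀ i : Fin 3, ∫ v : E3, (c i - v i) * fderiv ℝ g v (e3 i) = ∫ v, g v := by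
    intro i
    have h1 : ∀ v, fderiv ℝ (fun v : E3 => c i - v i) v (e3 i) = -1 := fun v => by
      rw [(hd i v).fderiv]; simp [e3]
    rw [integral_mul_fderiv_eq_neg_fderiv_mul_of_integrable
      (by simp only [h1, neg_one_mul]; exact hgint.neg) (hint i)
      (Continuous.integrable_of_hasCompactSupport
        ((by fun_prop : Continuous fun v : E3 => c i - v i).mul hg.continuous) hs.mul_left)
      (fun v _ => (hd i v).differentiableAt)
      (fun v _ => hg.differentiable one_ne_zero v)]
    simp only [h1, neg_one_mul, integral_neg, neg_neg]
  simp_rw [map_eq_sum_e3 _ (c - _), PiLp.sub_apply]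
  rw [integral_finsetSum _ fun i _ => hint i]
  simp [key]

section SlabIntegrability

variable {E : Type*} [NormedAddCommGroup E] [MeasurableSpace E] [BorelSpace E]
  {μ : Measure E} [IsFiniteMeasureOnCompacts μ] {T : ℝ}

lemma integrableOn_slab {g : ℝ × E → ℝ} {K : Set E} (hK : IsCompact K)
    (hg : ContinuousOn g (Set.Icc 0 T ×ˢ Set.univ)) {t : ℝ} (ht : t ∈ Set.Icc 0 T) :
    IntegrableOn (fun z => g (t, z)) K μ :=
  (hg.comp (by fun_prop) fun _ _ => ⟨ht, trivial⟩).integrableOn_compact hK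

lemma integrable_prod_slab [SFinite μ] [SecondCountableTopology E] {g : ℝ × E → ℝ} {K : Set E} (hK : IsCompact K)
    (hg : ContinuousOn g (Set.Icc 0 T ×ˢ Set.univ)) {T' : ℝ} (hT' : T' ∈ Set.Icc 0 T) :
    Integrable g ((volume.restrict (Set.uIoc 0 T')).prod (μ.restrict K)) := by
  rw [Measure.prod_restrict, Set.uIoc_of_le hT'.1]
  refine IntegrableOn.mono_set (t := Set.Icc 0 T ×ˢ K) ?_ ?_
  · exact (hg.mono (Set.prod_mono_right (Set.subset_univ K))).integrableOn_compact
      (isCompact_Icc.prod hK)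
  · exact Set.prod_mono_left fun s hs => ⟨hs.1.le, hs.2.trans hT'.2⟩

lemma intervalIntegrable_slab [SFinite μ] [SecondCountableTopology E] {g : ℝ × E → ℝ} {K : Set E} (hK : IsCompact K)
    (hg : ContinuousOn g (Set.Icc 0 T ×ˢ Set.univ)) {T' : ℝ} (hT' : T' ∈ Set.Icc 0 T) :
    IntervalIntegrable (fun t => ∫ z in K, g (t, z) ∂μ) volume 0 T' := by
  rw [intervalIntegrable_iff]
  exact (integrable_prod_slab hK hg hT').integral_prod_left

end SlabIntegrability

section Slab

variable {E F : Type*} [NormedAddCommGroup E] [NormedSpace ℝ E]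
  [NormedAddCommGroup F] [NormedSpace ℝ F] {T : ℝ} {U : ℝ × E → F}

lemma uniqueDiffOn_slab (hT : 0 < T) :
    UniqueDiffOn ℝ (Set.Icc 0 T ×ˢ (Set.univ : Set E)) :=
  (uniqueDiffOn_Icc hT).prod uniqueDiffOn_univ

lemma hasFDerivAt_slab (hU : ContDiffOn ℝ 1 U (Set.Icc 0 T ×ˢ Set.univ)) {t : ℝ}
    (ht : t ∈ Set.Icc 0 T) (y : E) :
    HasFDerivAt (fun y => U (t, y))
      ((fderivWithin ℝ U (Set.Icc 0 T ×ˢ Set.univ) (t, y)).comp (ContinuousLinearMap.inr ℝ ℝ E))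
      y := by
  have h := (hU.differentiableOn one_ne_zero (t, y) ⟨ht, trivial⟩).hasFDerivWithinAt
  rw [← hasFDerivWithinAt_univ]
  exact h.comp y (hasFDerivAt_prodMk_right t y).hasFDerivWithinAt fun _ _ => ⟨ht, trivial⟩

lemma hasDerivWithinAt_slab (hU : ContDiffOn ℝ 1 U (Set.Icc 0 T ×ˢ Set.univ)) {t : ℝ}
    (ht : t ∈ Set.Icc 0 T) (y : E) :
    HasDerivWithinAt (fun s => U (s, y))
      (fderivWithin ℝ U (Set.Icc 0 T ×ˢ Set.univ) (t, y) (1, 0)) (Set.Icc 0 T) t := by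
  have h := (hU.differentiableOn one_ne_zero (t, y) ⟨ht, trivial⟩).hasFDerivWithinAt
  exact h.comp_hasDerivWithinAt (f := fun s => (s, y)) t
    ((hasDerivWithinAt_id t _).prodMk (hasDerivWithinAt_const t _ y)) fun s hs => ⟨hs, trivial⟩

lemma contDiff_slab (hU : ContDiffOn ℝ 1 U (Set.Icc 0 T ×ˢ Set.univ)) {t : ℝ}
    (ht : t ∈ Set.Icc 0 T) : ContDiff ℝ 1 fun y => U (t, y) := by
  rw [← contDiffOn_univ]
  exact hU.comp (f := fun y => (t, y)) (by fun_prop) fun _ _ => ⟨ht, trivial⟩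

lemma continuousOn_fderivWithin_slab (hT : 0 < T)
    (hU : ContDiffOn ℝ 1 U (Set.Icc 0 T ×ˢ Set.univ)) :
    ContinuousOn (fderivWithin ℝ U (Set.Icc 0 T ×ˢ Set.univ)) (Set.Icc 0 T ×ˢ Set.univ) :=
  hU.continuousOn_fderivWithin (uniqueDiffOn_slab hT) le_rfl

variable [MeasurableSpace E] [BorelSpace E] {μ : Measure E} [IsFiniteMeasureOnCompacts μ]
  [SFinite μ] [SecondCountableTopology E]

lemma intervalIntegral_timeDeriv_slab (hT : 0 < T) {G : ℝ × E → ℝ} {K : Set E}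
    (hK : IsCompact K) (hG : ContDiffOn ℝ 1 G (Set.Icc 0 T ×ˢ Set.univ)) {T' : ℝ}
    (hT' : T' ∈ Set.Icc 0 T) :
    ∫ t in (0 : ℝ)..T', ∫ z in K, fderivWithin ℝ G (Set.Icc 0 T ×ˢ Set.univ) (t, z) (1, 0) ∂μ
      = (∫ z in K, G (T', z) ∂μ) - ∫ z in K, G (0, z) ∂μ := by
  have hc : ContinuousOn
      (fun q => fderivWithin ℝ G (Set.Icc 0 T ×ˢ Set.univ) q (1, 0))
      (Set.Icc 0 T ×ˢ Set.univ) :=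
    (continuousOn_fderivWithin_slab hT hG).clm_apply continuousOn_const
  rw [intervalIntegral_integral_swap (integrable_prod_slab hK hc hT'),
    ← integral_sub (integrableOn_slab hK hG.continuousOn hT')
      (integrableOn_slab hK hG.continuousOn ⟨le_rfl, hT.le⟩)]
  refine integral_congr_ae (ae_of_all _ fun z => ?_)
  have hsub : Set.Icc 0 T' ⊆ Set.Icc 0 T := Set.Icc_subset_Icc_right hT'.2
  refine intervalIntegral.integral_eq_sub_of_hasDerivAt_of_le (f := fun s => G (s, z)) hT'.1
    (fun s hs => ((hasDerivWithinAt_slab hG (hsub hs) z).continuousWithinAt).mono hsub)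
    (fun s hs => (hasDerivWithinAt_slab hG (hsub (Set.Ioo_subset_Icc_self hs)) z).hasDerivAt
      (Icc_mem_nhds hs.1 (hs.2.trans_le hT'.2))) ?_
  rw [intervalIntegrable_iff_integrableOn_Icc_of_le hT'.1]
  exact ContinuousOn.integrableOn_compact isCompact_Icc
    (hc.comp (f := fun s => (s, z)) (by fun_prop) fun s hs => ⟨hsub hs, trivial⟩)

end Slab

section PhaseSpace

variable {T R : ℝ} {G : ℝ × E3 × E3 → ℝ}

lemma isCompact_phaseCell (R : ℝ) : IsCompact (cube3 ×ˢ Metric.closedBall (0 : E3) R) :=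
  isCompact_cube3.prod (isCompact_closedBall 0 R)

lemma intT3_integral_eq {h : E3 × E3 → ℝ} (hc : Continuous h)
    (hsupp : ∀ x v : E3, R ≤ ‖v‖ → h (x, v) = 0) :
    intT3 (fun x => ∫ v, h (x, v)) =
      ((2 * π) ^ 3)⁻¹ * ∫ z in cube3 ×ˢ Metric.closedBall (0 : E3) R, h z := by
  have hK := hc.continuousOn.integrableOn_compact (μ := volume) (isCompact_phaseCell R)
  rw [Measure.volume_eq_prod] at hK ⊢
  rw [intT3, setIntegral_prod _ hK]
  congr 2
  ext x
  refine (setIntegral_eq_integral_of_forall_compl_eq_zero fun v hv => hsupp x v ?_).symm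
  rw [mem_closedBall_zero_iff, not_le] at hv
  exact hv.le

lemma integral_spaceTransport_eq_zero (hT : 0 < T)
    (hG : ContDiffOn ℝ 1 G (Set.Icc 0 T ×ˢ Set.univ))
    (hper : ∀ t ∈ Set.Icc (0:ℝ) T, ∀ (x v : E3) (i : Fin 3),
      G (t, x + (2 * π) • e3 i, v) = G (t, x, v)) {t : ℝ} (ht : t ∈ Set.Icc 0 T) :
    ∫ z in cube3 ×ˢ Metric.closedBall (0 : E3) R,
      fderivWithin ℝ G (Set.Icc 0 T ×ˢ Set.univ) (t, z) (0, z.2, 0) = 0 := by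
  have hint : IntegrableOn
      (fun z : E3 × E3 => fderivWithin ℝ G (Set.Icc 0 T ×ˢ Set.univ) (t, z) (0, z.2, 0))
      (cube3 ×ˢ Metric.closedBall (0 : E3) R) volume :=
    integrableOn_slab (T := T) (isCompact_phaseCell R)
      (g := fun q => fderivWithin ℝ G (Set.Icc 0 T ×ˢ Set.univ) q (0, q.2.2, 0))
      ((continuousOn_fderivWithin_slab hT hG).clm_apply (by fun_prop)) ht
  rw [Measure.volume_eq_prod, IntegrableOn, ← Measure.prod_restrict] at hint
  rw [Measure.volume_eq_prod, ← Measure.prod_restrict, integral_prod_symm _ hint]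
  refine integral_eq_zero_of_ae (ae_of_all _ fun v => ?_)
  have hd : ∀ x, HasFDerivAt (fun y => G (t, y, v)) _ x := fun x =>
    (hasFDerivAt_slab hG ht (x, v)).comp (g := fun z => G (t, z)) x (hasFDerivAt_prodMk_left x v)
  have h0 := integral_cube3_fderiv_eq_zero (fun y => G (t, y, v))
    ((contDiff_slab hG ht).comp (contDiff_id.prodMk contDiff_const))
    (fun x i => hper t ht x v i) v
  simp_rw [(hd _).fderiv] at h0
  simpa using h0

lemma integral_velocityTransport_eq (hT : 0 < T)
    (hG : ContDiffOn ℝ 1 G (Set.Icc 0 T ×ˢ Set.univ))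
    (hsupp : ∀ t ∈ Set.Icc (0:ℝ) T, ∀ x v : E3, R ≤ ‖v‖ → G (t, x, v) = 0)
    {c : E3 → E3} (hc : Continuous c) {t : ℝ} (ht : t ∈ Set.Icc 0 T) :
    ∫ z in cube3 ×ˢ Metric.closedBall (0 : E3) R,
      fderivWithin ℝ G (Set.Icc 0 T ×ˢ Set.univ) (t, z) (0, 0, c z.1 - z.2)
      = 3 * ∫ z in cube3 ×ˢ Metric.closedBall (0 : E3) R, G (t, z) := by
  have hint : IntegrableOn
      (fun z : E3 × E3 => fderivWithin ℝ G (Set.Icc 0 T ×ˢ Set.univ) (t, z) (0, 0, c z.1 - z.2))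
      (cube3 ×ˢ Metric.closedBall (0 : E3) R) volume :=
    integrableOn_slab (T := T) (isCompact_phaseCell R)
      (g := fun q => fderivWithin ℝ G (Set.Icc 0 T ×ˢ Set.univ) q (0, 0, c q.2.1 - q.2.2))
      ((continuousOn_fderivWithin_slab hT hG).clm_apply (by fun_prop)) ht
  have hintG : IntegrableOn (fun z : E3 × E3 => G (t, z))
      (cube3 ×ˢ Metric.closedBall (0 : E3) R) volume :=
    integrableOn_slab (isCompact_phaseCell R) hG.continuousOn ht
  rw [Measure.volume_eq_prod] at hint hintG ⊢
  rw [setIntegral_prod _ hint, setIntegral_prod _ hintG, ← integral_const_mul]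
  refine integral_congr_ae (ae_of_all _ fun x => ?_)
  have hzero : ∀ v ∉ Metric.closedBall (0 : E3) R, G (t, x, v) = 0 := fun v hv => by
    rw [mem_closedBall_zero_iff, not_le] at hv
    exact hsupp t ht x v hv.le
  have hd : ∀ v, HasFDerivAt (fun y => G (t, x, y)) _ v := fun v =>
    (hasFDerivAt_slab hG ht (x, v)).comp (g := fun z => G (t, z)) v (hasFDerivAt_prodMk_right x v)
  have h0 := integral_fderiv_sub_eq (fun y => G (t, x, y))
    ((contDiff_slab hG ht).comp (contDiff_const.prodMk contDiff_id))
    (HasCompactSupport.intro (isCompact_closedBall 0 R) hzero) (c x)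
  rw [← setIntegral_eq_integral_of_forall_compl_eq_zero (s := Metric.closedBall (0 : E3) R) hzero,
    ← setIntegral_eq_integral_of_forall_compl_eq_zero (s := Metric.closedBall (0 : E3) R)
      fun v hv => ?_] at h0
  · simp_rw [(hd _).fderiv] at h0
    simpa using h0
  · have hev : (fun y => G (t, x, y)) =ᶠ[nhds v] fun _ => 0 := by
      filter_upwards [Metric.isClosed_closedBall.isOpen_compl.mem_nhds hv] with y hy
      exact hzero y hy
    rw [hev.fderiv_eq]
    simp

/-- Integrated balance law for a density transported by the field `(v, ε⁻¹ (c - v))`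
with source `H`. -/
lemma kinetic_balance (hT : 0 < T) (hG : ContDiffOn ℝ 1 G (Set.Icc 0 T ×ˢ Set.univ))
    (hper : ∀ t ∈ Set.Icc (0:ℝ) T, ∀ (x v : E3) (i : Fin 3),
      G (t, x + (2 * π) • e3 i, v) = G (t, x, v))
    (hsupp : ∀ t ∈ Set.Icc (0:ℝ) T, ∀ x v : E3, R ≤ ‖v‖ → G (t, x, v) = 0)
    {c : ℝ × E3 → E3} (hc : ContinuousOn c (Set.Icc 0 T ×ˢ Set.univ))
    {H : ℝ × E3 × E3 → ℝ} {k : ℝ}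
    (hH : ∀ t ∈ Set.Icc (0:ℝ) T, ∀ x v : E3,
      fderivWithin ℝ G (Set.Icc 0 T ×ˢ Set.univ) (t, x, v) (1, v, k • (c (t, x) - v))
        = 3 * k * G (t, x, v) + H (t, x, v))
    {T' : ℝ} (hT' : T' ∈ Set.Icc 0 T) :
    ∫ t in (0:ℝ)..T', ∫ z in cube3 ×ˢ Metric.closedBall (0 : E3) R, H (t, z)
      = (∫ z in cube3 ×ˢ Metric.closedBall (0 : E3) R, G (T', z))
        - ∫ z in cube3 ×ˢ Metric.closedBall (0 : E3) R, G (0, z) := by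
  rw [← intervalIntegral_timeDeriv_slab hT (isCompact_phaseCell R) hG hT']
  refine intervalIntegral.integral_congr fun t ht => ?_
  rw [Set.uIcc_of_le hT'.1] at ht
  replace ht : t ∈ Set.Icc 0 T := ⟨ht.1, ht.2.trans hT'.2⟩
  have hD := continuousOn_fderivWithin_slab hT hG
  have hct : Continuous fun x => c (t, x) := by
    rw [← continuousOn_univ]
    exact hc.comp (f := fun x => (t, x)) (by fun_prop) fun _ _ => ⟨ht, trivial⟩
  have hDt : Continuous fun z => fderivWithin ℝ G (Set.Icc 0 T ×ˢ Set.univ) (t, z) := by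
    rw [← continuousOn_univ]
    exact hD.comp (f := fun x => (t, x)) (by fun_prop) fun _ _ => ⟨ht, trivial⟩
  have hGt : Continuous fun z => G (t, z) := (contDiff_slab hG ht).continuous
  have hI : ∀ {h : E3 × E3 → ℝ}, Continuous h →
      IntegrableOn h (cube3 ×ˢ Metric.closedBall (0 : E3) R) volume := fun h =>
    h.continuousOn.integrableOn_compact (isCompact_phaseCell R)
  have hsplit : ∀ z : E3 × E3, H (t, z) =
      fderivWithin ℝ G (Set.Icc 0 T ×ˢ Set.univ) (t, z) (1, 0)
      + fderivWithin ℝ G (Set.Icc 0 T ×ˢ Set.univ) (t, z) (0, z.2, 0)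
      + k * (fderivWithin ℝ G (Set.Icc 0 T ×ˢ Set.univ) (t, z) (0, 0, c (t, z.1) - z.2)
        - 3 * G (t, z)) := by
    rintro ⟨x, v⟩
    have h := hH t ht x v
    have hv : ((1, v, k • (c (t, x) - v)) : ℝ × E3 × E3) =
        (1, 0) + (0, v, 0) + k • (0, 0, c (t, x) - v) := by
      ext <;> simp
    rw [hv, map_add, map_add, map_smul, smul_eq_mul] at h
    linear_combination -h
  have hspace := integral_spaceTransport_eq_zero (R := R) hT hG hper ht
  have hvel := integral_velocityTransport_eq hT hG hsupp hct ht
  simp_rw [hsplit]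
  generalize fderivWithin ℝ G (Set.Icc 0 T ×ˢ Set.univ) = D at hDt hspace hvel ⊢
  have hI_time := hI (h := fun z => D (t, z) (1, 0)) (hDt.clm_apply continuous_const)
  have hI_space := hI (h := fun z => D (t, z) (0, z.2, 0))
    (hDt.clm_apply (by fun_prop))
  have hI_vel := hI (h := fun z => D (t, z) (0, 0, c (t, z.1) - z.2))
    (hDt.clm_apply (continuous_const.prodMk (continuous_const.prodMk
      ((hct.comp continuous_fst).sub continuous_snd))))
  have hI_G := hI (h := fun z => 3 * G (t, z)) (continuous_const.mul hGt)
  have hI_adv : IntegrableOn (fun z => D (t, z) (1, 0) + D (t, z) (0, z.2, 0))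
      (cube3 ×ˢ Metric.closedBall (0 : E3) R) volume := hI_time.add hI_space
  have hI_drag : IntegrableOn
      (fun z => k * (D (t, z) (0, 0, c (t, z.1) - z.2) - 3 * G (t, z)))
      (cube3 ×ˢ Metric.closedBall (0 : E3) R) volume := (hI_vel.sub hI_G).const_mul k
  rw [integral_add hI_adv hI_drag, integral_add hI_time hI_space, integral_const_mul,
    integral_sub hI_vel hI_G, integral_const_mul, hspace, hvel]
  ring

end PhaseSpace

/-- The kinetic density weighted by the `r`-th power of the relative velocity has the higher
dissipation and the material derivative of the fluid velocity as its sources. -/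
lemma fderivWithin_weighted_density {ε T r : ℝ} (hT : 0 < T) (hr : 2 ≤ r)
    {V : ℝ × E3 → E3} {F : ℝ × E3 × E3 → ℝ}
    (hV : ContDiffOn ℝ 1 V (Set.Icc 0 T ×ˢ Set.univ))
    (hF : ContDiffOn ℝ 1 F (Set.Icc 0 T ×ˢ Set.univ)) {t : ℝ} (ht : t ∈ Set.Icc 0 T) (x v : E3)
    (hvlasov : fderivWithin ℝ F (Set.Icc 0 T ×ˢ Set.univ) (t, x, v) (1, v, ε⁻¹ • (V (t, x) - v))
      = 3 * ε⁻¹ * F (t, x, v)) :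
    fderivWithin ℝ (fun q : ℝ × E3 × E3 => F q * ‖q.2.2 - V (q.1, q.2.1)‖ ^ r)
        (Set.Icc 0 T ×ˢ Set.univ) (t, x, v) (1, v, ε⁻¹ • (V (t, x) - v))
      = 3 * ε⁻¹ * (F (t, x, v) * ‖v - V (t, x)‖ ^ r)
        - r * (ε⁻¹ * (F (t, x, v) * ‖v - V (t, x)‖ ^ r)
          + F (t, x, v) * ⟪fderivWithin ℝ V (Set.Icc 0 T ×ˢ Set.univ) (t, x) (1, v),
              v - V (t, x)⟫ * ‖v - V (t, x)‖ ^ (r - 2)) := by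
  have hq : (t, x, v) ∈ Set.Icc 0 T ×ˢ (Set.univ : Set (E3 × E3)) := ⟨ht, trivial⟩
  have hVd := (hV.differentiableOn one_ne_zero (t, x) ⟨ht, trivial⟩).hasFDerivWithinAt
  have hFd := (hF.differentiableOn one_ne_zero (t, x, v) hq).hasFDerivWithinAt
  let p : ℝ × E3 × E3 →L[ℝ] ℝ × E3 := (ContinuousLinearMap.fst ℝ ℝ (E3 × E3)).prod
    ((ContinuousLinearMap.fst ℝ E3 E3).comp (ContinuousLinearMap.snd ℝ ℝ (E3 × E3)))
  let s : ℝ × E3 × E3 →L[ℝ] E3 :=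
    (ContinuousLinearMap.snd ℝ E3 E3).comp (ContinuousLinearMap.snd ℝ ℝ (E3 × E3))
  have hVp : HasFDerivWithinAt (fun q : ℝ × E3 × E3 => V (q.1, q.2.1))
      ((fderivWithin ℝ V (Set.Icc 0 T ×ˢ Set.univ) (t, x)).comp p)
      (Set.Icc 0 T ×ˢ Set.univ) (t, x, v) :=
    hVd.comp (f := p) (t, x, v) (p.hasFDerivWithinAt (x := (t, x, v))) fun q hq => ⟨hq.1, trivial⟩
  have hW := (s.hasFDerivWithinAt (x := (t, x, v))).sub hVp
  have hφ := (hasFDerivAt_norm_rpow (v - V (t, x)) (by linarith : 1 < r)).comp_hasFDerivWithinAt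
    (f := fun q : ℝ × E3 × E3 => q.2.2 - V (q.1, q.2.1)) (t, x, v) hW
  have hGd : fderivWithin ℝ (fun q : ℝ × E3 × E3 => F q * ‖q.2.2 - V (q.1, q.2.1)‖ ^ r)
      (Set.Icc 0 T ×ˢ Set.univ) (t, x, v) = _ :=
    (hFd.mul hφ).fderivWithin (uniqueDiffOn_slab hT _ hq)
  have hrel : ‖v - V (t, x)‖ ^ (r - 2) * ⟪v - V (t, x), v - V (t, x)⟫ = ‖v - V (t, x)‖ ^ r := by
    rw [real_inner_self_eq_norm_sq, ← rpow_natCast,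
      ← rpow_add_of_nonneg (norm_nonneg _) (by linarith) (by norm_num)]
    norm_num
  rw [hGd]
  simp only [add_apply, smul_apply, sub_apply, p, s, ContinuousLinearMap.comp_apply,
    ContinuousLinearMap.prod_apply, ContinuousLinearMap.coe_fst', ContinuousLinearMap.coe_snd',
    innerSL_apply_apply, smul_eq_mul, hvlasov, Function.comp_apply]
  rw [inner_sub_right (v - V (t, x)) (ε⁻¹ • _), inner_smul_right, ← neg_sub v (V (t, x)),
    inner_neg_right, 
    real_inner_comm (fderivWithin ℝ V _ (t, x) (1, v)) (v - V (t, x)), ← hrel]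
  ring


/-- **Higher dissipation identity** (Statement 15, classical form of Lemma 5.3).
Let `ε > 0`, `T > 0` and `r ≥ 2` be real.  Let `u` be `C¹` on `[0,T]×ℝ³` and
`2π`-periodic in each space coordinate, and let `f ≥ 0` be `C¹`, `2π`-periodic in `x`,
vanishing for `|v| ≥ R₀`, satisfying the fine-regime Vlasov equation
`∂ₜf + v·∇ₓf + (1/ε) div_v[f(u − v)] = 0` pointwise.  Then for every `T′ ∈ [0,T]`,
`∫₀^{T′} D^{(r)}(t) dt
  = −(1/r)[∫∫ f(T′)|v−u(T′)|^r/ε^{r−1} − ∫∫ f(0)|v−u(0)|^r/ε^{r−1}]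
    − ∫₀^{T′} ∫∫ f (∂ₜu + (Dₓu)v)·(v−u)|v−u|^{r−2}/ε^{r−1}`,
where `D^{(r)}(t) = ∫_{𝕋³×ℝ³} f(t,x,v)|v−u(t,x)|^r/ε^r dx dv` (the integrand of the
last integral vanishing where `v = u(t,x)`, automatically since the factor
`(v−u)·(⋯)` is `0` there). -/
theorem higher_dissipation_identity
    (ε T r : ℝ) (hε : 0 < ε) (hT : 0 < T) (hr : 2 ≤ r)
    (u : ℝ → E3 → E3) (f : ℝ → E3 → E3 → ℝ)
    (hu_reg : ContDiffOn ℝ 1 (fun q : ℝ × E3 => u q.1 q.2) (Set.Icc 0 T ×ˢ Set.univ))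
    (hu_per : ∀ t ∈ Set.Icc (0:ℝ) T, ∀ (x : E3) (i : Fin 3),
      u t (x + (2 * π) • e3 i) = u t x)
    (hf_nonneg : ∀ t ∈ Set.Icc (0:ℝ) T, ∀ (x v : E3), 0 ≤ f t x v)
    (hf_reg : ContDiffOn ℝ 1 (fun q : ℝ × E3 × E3 => f q.1 q.2.1 q.2.2)
      (Set.Icc 0 T ×ˢ (Set.univ : Set (E3 × E3))))
    (hf_per : ∀ t ∈ Set.Icc (0:ℝ) T, ∀ (x v : E3) (i : Fin 3),
      f t (x + (2 * π) • e3 i) v = f t x v)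
    (hf_supp : ∃ R₀ > (0:ℝ), ∀ t ∈ Set.Icc (0:ℝ) T, ∀ (x v : E3), R₀ ≤ ‖v‖ → f t x v = 0)
    (hvlasov : ∀ t ∈ Set.Icc (0:ℝ) T, ∀ (x v : E3),
      derivWithin (fun s => f s x v) (Set.Icc 0 T) t
        + ∑ i, v i * fderiv ℝ (fun y => f t y v) x (e3 i)
        + ε⁻¹ * ∑ i, fderiv ℝ (fun w => f t x w * (u t x i - w i)) v (e3 i) = 0) :
    ∀ T' ∈ Set.Icc (0:ℝ) T,
      ∫ t in (0:ℝ)..T', intT3 (fun x => ∫ v : E3, f t x v * ‖v - u t x‖ ^ r / ε ^ r)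
        = -(1 / r) *
            (intT3 (fun x => ∫ v : E3, f T' x v * ‖v - u T' x‖ ^ r / ε ^ (r - 1))
              - intT3 (fun x => ∫ v : E3, f 0 x v * ‖v - u 0 x‖ ^ r / ε ^ (r - 1)))
          - ∫ t in (0:ℝ)..T', intT3 (fun x => ∫ v : E3,
              f t x v *
                ⟪derivWithin (fun s => u s x) (Set.Icc 0 T) t + fderiv ℝ (u t) x v,
                  v - u t x⟫ *
                ‖v - u t x‖ ^ (r - 2) / ε ^ (r - 1)) := by
  intro T' hT'
  obtain ⟨R, hR, hsupp⟩ := hf_supp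
  set V : ℝ × E3 → E3 := fun q => u q.1 q.2 with hV_def
  set F : ℝ × E3 × E3 → ℝ := fun q => f q.1 q.2.1 q.2.2 with hF_def
  set DV := fderivWithin ℝ V (Set.Icc 0 T ×ˢ Set.univ) with hDV_def
  set G : ℝ × E3 × E3 → ℝ := fun q => F q * ‖q.2.2 - V (q.1, q.2.1)‖ ^ r with hG_def
  set Q : ℝ × E3 × E3 → ℝ := fun q =>
    F q * ⟪DV (q.1, q.2.1) (1, q.2.2), q.2.2 - V (q.1, q.2.1)⟫
      * ‖q.2.2 - V (q.1, q.2.1)‖ ^ (r - 2) with hQ_def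
  have hmaps : Set.MapsTo (fun q : ℝ × E3 × E3 => (q.1, q.2.1))
      (Set.Icc 0 T ×ˢ Set.univ) (Set.Icc 0 T ×ˢ Set.univ) := fun q hq => ⟨hq.1, trivial⟩
  have hVp : ContDiffOn ℝ 1 (fun q : ℝ × E3 × E3 => V (q.1, q.2.1))
      (Set.Icc 0 T ×ˢ Set.univ) :=
    hu_reg.comp (f := fun q : ℝ × E3 × E3 => (q.1, q.2.1)) (by fun_prop) hmaps
  have hW : ContDiffOn ℝ 1 (fun q : ℝ × E3 × E3 => q.2.2 - V (q.1, q.2.1))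
      (Set.Icc 0 T ×ˢ Set.univ) := ContDiffOn.sub (by fun_prop) hVp
  have hG : ContDiffOn ℝ 1 G (Set.Icc 0 T ×ˢ Set.univ) :=
    hf_reg.mul ((contDiff_norm_rpow (by linarith : 1 < r)).comp_contDiffOn hW)
  have hQ : ContinuousOn Q (Set.Icc 0 T ×ˢ Set.univ) := by
    have hDV : ContinuousOn (fun q : ℝ × E3 × E3 => DV (q.1, q.2.1))
        (Set.Icc 0 T ×ˢ Set.univ) :=
      (continuousOn_fderivWithin_slab hT hu_reg).comp
        (f := fun q : ℝ × E3 × E3 => (q.1, q.2.1)) (by fun_prop) hmaps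
    exact (hf_reg.continuousOn.mul
      ((hDV.clm_apply (by fun_prop)).inner hW.continuousOn)).mul
      (hW.continuousOn.norm.rpow_const fun _ _ => Or.inr (by linarith))
  have hFv : ∀ t ∈ Set.Icc (0:ℝ) T, ∀ x v : E3,
      fderivWithin ℝ F (Set.Icc 0 T ×ˢ Set.univ) (t, x, v) (1, v, ε⁻¹ • (V (t, x) - v))
        = 3 * ε⁻¹ * F (t, x, v) := by
    intro t ht x v
    set D := fderivWithin ℝ F (Set.Icc 0 T ×ˢ Set.univ) (t, x, v)
    have hz := hasFDerivAt_slab hf_reg ht (x, v)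
    have hs : derivWithin (fun s => f s x v) (Set.Icc 0 T) t = D (1, 0) :=
      (hasDerivWithinAt_slab hf_reg ht (x, v)).derivWithin (uniqueDiffOn_Icc hT t ht)
    have hx : fderiv ℝ (fun y => f t y v) x = (D.comp (.inr ℝ ℝ (E3 × E3))).comp (.inl ℝ E3 E3) :=
      (hz.comp (g := fun z => F (t, z)) (f := fun y => (y, v)) x (hasFDerivAt_prodMk_left x v)).fderiv
    have hv : HasFDerivAt (fun w => f t x w)
        ((D.comp (.inr ℝ ℝ (E3 × E3))).comp (.inr ℝ E3 E3)) v :=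
      hz.comp (g := fun z => F (t, z)) (f := fun w => (x, w)) v (hasFDerivAt_prodMk_right x v)
    have hdiv : ∀ i : Fin 3, fderiv ℝ (fun w : E3 => f t x w * (u t x i - w i)) v (e3 i)
        = (V (t, x) - v) i * ((D.comp (.inr ℝ ℝ (E3 × E3))).comp (.inr ℝ E3 E3)) (e3 i)
          - F (t, x, v) := by
      intro i
      have h : fderiv ℝ (fun w : E3 => f t x w * (u t x i - w i)) v = _ := (hv.mul
        ((EuclideanSpace.proj i : E3 →L[ℝ] ℝ).hasFDerivAt.const_sub (u t x i))).fderiv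
      rw [h]
      simp [e3, hF_def, hV_def]
      ring
    have h := hvlasov t ht x v
    rw [hs, hx, ← map_eq_sum_e3] at h
    simp only [hdiv] at h
    rw [Finset.sum_sub_distrib, ← map_eq_sum_e3] at h
    simp only [ContinuousLinearMap.comp_apply, ContinuousLinearMap.inl_apply,
      ContinuousLinearMap.inr_apply, Finset.sum_const, Finset.card_univ, Fintype.card_fin,
      nsmul_eq_mul] at h
    have hdir : ((1, v, ε⁻¹ • (V (t, x) - v)) : ℝ × E3 × E3) =
        (1, 0) + (0, v, 0) + ε⁻¹ • (0, 0, V (t, x) - v) := by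
      ext <;> simp
    rw [hdir, map_add, map_add, map_smul, smul_eq_mul]
    push_cast at h
    linear_combination h
  have hbal := kinetic_balance (R := R) (k := ε⁻¹) (H := fun q => - r * (ε⁻¹ * G q + Q q))
    hT hG ?_ ?_ hu_reg.continuousOn ?_ hT'
  rotate_left
  · intro t ht x v i
    simp only [hG_def, hF_def, hV_def, hf_per t ht, hu_per t ht]
  · intro t ht x v hv
    simp only [hG_def, hF_def, hsupp t ht x v hv, zero_mul]
  · intro t ht x v
    rw [fderivWithin_weighted_density hT hr hu_reg hf_reg ht x v (hFv t ht x v)]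
    ring
  have hslice : ∀ {g : ℝ × E3 × E3 → ℝ}, ContinuousOn g (Set.Icc 0 T ×ˢ Set.univ) →
      ∀ t ∈ Set.Icc 0 T, Continuous fun z => g (t, z) := by
    intro g hg t ht
    rw [← continuousOn_univ]
    exact hg.comp (f := fun z => (t, z)) (by fun_prop) fun _ _ => ⟨ht, trivial⟩
  have hIG : ∀ t ∈ Set.Icc 0 T, ∀ k : ℝ,
      intT3 (fun x => ∫ v : E3, f t x v * ‖v - u t x‖ ^ r / k) =
        ((2 * π) ^ 3)⁻¹ * ((∫ z in cube3 ×ˢ Metric.closedBall (0 : E3) R, G (t, z)) / k) := by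
    intro t ht k
    rw [← integral_div, ← intT3_integral_eq (h := fun z => G (t, z) / k)
      ((hslice hG.continuousOn t ht).div_const k)]
    intro x v hv
    simp only [hG_def, hF_def, hsupp t ht x v hv, zero_mul, zero_div]
  have hIQ : ∀ t ∈ Set.Icc 0 T,
      intT3 (fun x => ∫ v : E3, f t x v *
          ⟪derivWithin (fun s => u s x) (Set.Icc 0 T) t + fderiv ℝ (u t) x v, v - u t x⟫ *
          ‖v - u t x‖ ^ (r - 2) / ε ^ (r - 1)) =
        ((2 * π) ^ 3)⁻¹ *
          ((∫ z in cube3 ×ˢ Metric.closedBall (0 : E3) R, Q (t, z)) / ε ^ (r - 1)) := by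
    intro t ht
    have hmat : ∀ x v : E3,
        derivWithin (fun s => u s x) (Set.Icc 0 T) t + fderiv ℝ (u t) x v = DV (t, x) (1, v) := by
      intro x v
      have h1 := (hasDerivWithinAt_slab hu_reg ht x).derivWithin (uniqueDiffOn_Icc hT t ht)
      have h2 := (hasFDerivAt_slab hu_reg ht x).fderiv
      rw [h1, h2, ContinuousLinearMap.comp_apply, ContinuousLinearMap.inr_apply, ← map_add]
      simp [hDV_def, hV_def]
    simp_rw [hmat]
    rw [← integral_div, ← intT3_integral_eq (h := fun z => Q (t, z) / ε ^ (r - 1))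
      ((hslice hQ t ht).div_const _)]
    intro x v hv
    simp only [hQ_def, hF_def, hsupp t ht x v hv, zero_mul, zero_div]
  have hsub : ∀ t ∈ Set.uIcc 0 T', t ∈ Set.Icc 0 T := fun t ht => by
    rw [Set.uIcc_of_le hT'.1] at ht
    exact ⟨ht.1, ht.2.trans hT'.2⟩
  rw [intervalIntegral.integral_congr fun t ht => hIG t (hsub t ht) (ε ^ r),
    intervalIntegral.integral_congr fun t ht => hIQ t (hsub t ht),
    hIG T' hT', hIG 0 ⟨le_rfl, hT.le⟩]
  simp only [intervalIntegral.integral_const_mul, intervalIntegral.integral_div]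
  have hIt : ∀ t ∈ Set.uIcc 0 T',
      ∫ z in cube3 ×ˢ Metric.closedBall (0 : E3) R, - r * (ε⁻¹ * G (t, z) + Q (t, z))
        = - r * (ε⁻¹ * (∫ z in cube3 ×ˢ Metric.closedBall (0 : E3) R, G (t, z))
          + ∫ z in cube3 ×ˢ Metric.closedBall (0 : E3) R, Q (t, z)) := by
    intro t ht
    rw [integral_const_mul, integral_add
      ((integrableOn_slab (isCompact_phaseCell R) hG.continuousOn (hsub t ht)).const_mul _)
      (integrableOn_slab (isCompact_phaseCell R) hQ (hsub t ht)), integral_const_mul]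
  rw [intervalIntegral.integral_congr hIt, intervalIntegral.integral_const_mul,
    intervalIntegral.integral_add
      ((intervalIntegrable_slab (isCompact_phaseCell R) hG.continuousOn hT').const_mul _)
      (intervalIntegrable_slab (isCompact_phaseCell R) hQ hT'),
    intervalIntegral.integral_const_mul] at hbal
  have hpow : ε ^ r = ε ^ (r - 1) * ε := by
    rw [← rpow_add_one hε.ne', sub_add_cancel]
  have hr0 : r ≠ 0 := by linarith
  have hpos : ε ^ (r - 1) ≠ 0 := (rpow_pos_of_pos hε _).ne'
  rw [← mul_sub, ← sub_div, ← hbal, hpow]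
  field_simp
  ring
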